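/- Let f₁, …, f_n : ℝ^d → ℝ be differentiable, convex, and each L-smooth, f(x) = (1/n)∑_{j=1}^n f_j(x); let h : ℝ^d → ℝ be convex, P = f + h, and x* a minimizer of P. Let ζ = d·λ²/(4(2^{b−1}−1)²) + d_λ(1−λ)² + 1/(NB) and suppose τ₂ = (5/3)ζ + 1/(2B) ≤ 1/2. On a probability space define random iterates with y₀ = z₀ = x̃⁰ = x₀ ∈ ℝ^d; for s = 0,…,S−1 set τ_{1,s} = 2/(s+4) and α_s = 1/(6Lτ_{1,s}); for t = 0,…,m−1 with k = sm + t: x_{k+1} = τ_{1,s}z_k + τ₂x̃^s + (1 − τ_{1,s} − τ₂)y_k; the random gradient estimates v_{k+1}, v̂_{k+1} satisfy, conditionally on all earlier iterates, E[v̂_{k+1}] = ∇f(x_{k+1}), E‖v̂_{k+1} − ∇f(x_{k+1})‖² ≤ (2L/B)·D_{k+1}, E‖v_{k+1} − ∇f(x_{k+1})‖² ≤ 4Lζ·D_{k+1}, and E‖v̂_{k+1} − v_{k+1}‖² ≤ 4L(ζ + 1/(2B))·D_{k+1}, where D_{k+1} = f(x̃^s) − f(x_{k+1}) − ⟨∇f(x_{k+1}),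 x̃^s − x_{k+1}⟩; y_{k+1} is the minimizer of y ↦ 2L‖y − x_{k+1}‖² + ⟨v_{k+1}, y⟩ + h(y); z_{k+1} is the minimizer of z ↦ (1/(2α_s))‖z − z_k‖² + ⟨v̂_{k+1}, z⟩ + h(z); and x̃^{s+1} = (1/m)∑_{t=1}^{m} y_{sm+t}. Then there exists a constant C > 0, independent of S, such that E[P(x̃^S) − P(x*)] ≤ (C/(mS²))·[m·(P(x₀) − P(x*)) + L‖x₀ − x*‖²]. -/

import Mathlib

open MeasureTheory ProbabilityTheory
open scoped ProbabilityTheory BigOperators RealInnerProductSpace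

section aux
set_option linter.unusedSectionVars false
variable {E : Type*} [NormedAddCommGroup E] [InnerProductSpace ℝ E] [CompleteSpace E]

theorem aux_line {F : E → ℝ} {gF : E → E} (hg : ∀ x, HasGradientAt F (gF x) x) (x e : E) (t : ℝ) :
    HasDerivAt (fun t : ℝ => F (x + t • e)) ⟪gF (x + t • e), e⟫ t := by
  have h1 := (hg (x + t • e)).hasFDerivAt
  have h2 : HasDerivAt (fun t : ℝ => x + t • e) e t := by
    simpa using ((hasDerivAt_id t).smul_const e).const_add x
  have := h1.comp_hasDerivAt t h2
  simpa [Function.comp_def] using this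

theorem aux_descent {F : E → ℝ} {gF : E → E} (hg : ∀ x, HasGradientAt F (gF x) x) {L : ℝ}
    (hL : ∀ x y, ‖gF x - gF y‖ ≤ L * ‖x - y‖) (x y : E) :
    F y ≤ F x + ⟪gF x, y - x⟫ + L / 2 * ‖y - x‖ ^ 2 := by
  set e := y - x with he
  let ψ : ℝ → ℝ := fun t => F (x + t • e) - (t * ⟪gF x, e⟫ + L / 2 * t ^ 2 * ‖e‖ ^ 2)
  have hd : ∀ t, HasDerivAt ψ (⟪gF (x + t • e), e⟫ - (⟪gF x, e⟫ + L * t * ‖e‖ ^ 2)) t := by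
    intro t
    refine (aux_line hg x e t).sub ?_
    have h1 : HasDerivAt (fun t : ℝ => t * ⟪gF x, e⟫) ⟪gF x, e⟫ t := by
      simpa using (hasDerivAt_id t).mul_const ⟪gF x, e⟫
    have h2 : HasDerivAt (fun t : ℝ => L / 2 * t ^ 2 * ‖e‖ ^ 2) (L * t * ‖e‖ ^ 2) t := by
      have := (((hasDerivAt_id t).pow 2).const_mul (L / 2)).mul_const (‖e‖ ^ 2)
      exact HasDerivAt.congr_deriv this (by
        change L / 2 * (((2 : ℕ) : ℝ) * t ^ 1 * 1) * ‖e‖ ^ 2 = L * t * ‖e‖ ^ 2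
        push_cast; ring)
    exact h1.add h2
  have hanti : AntitoneOn ψ (Set.Ici 0) := by
    apply antitoneOn_of_deriv_nonpos (convex_Ici 0)
    · exact fun t _ => (hd t).continuousAt.continuousWithinAt
    · exact fun t _ => (hd t).differentiableAt.differentiableWithinAt
    · intro t ht
      rw [interior_Ici] at ht
      rw [(hd t).deriv]
      have h1 : ⟪gF (x + t • e) - gF x, e⟫ ≤ ‖gF (x + t • e) - gF x‖ * ‖e‖ :=
        real_inner_le_norm _ _
      have h2 := hL (x + t • e) x
      rw [add_sub_cancel_left, norm_smul, Real.norm_of_nonneg (le_of_lt ht)] at h2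
      rw [inner_sub_left] at h1
      have h3 := mul_le_mul_of_nonneg_right h2 (norm_nonneg e)
      nlinarith
  have := hanti (Set.mem_Ici.2 le_rfl) (Set.mem_Ici.2 zero_le_one) zero_le_one
  simp only [ψ, he] at this
  simp at this
  rw [← he] at this
  linarith

theorem aux_lim {A K : ℝ} (h : ∀ θ : ℝ, 0 < θ → θ < 1 → 0 ≤ A + θ * K) : 0 ≤ A := by
  by_contra! hA
  have hK : 0 < |K| + |A| + 1 := by positivity
  have h1 := h (|A| / (2 * (|K| + |A| + 1))) (by have := abs_pos.2 hA.ne; positivity) (by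
    rw [div_lt_one (by positivity)]; have := abs_nonneg K; have := abs_nonneg A; linarith)
  have h2 : |A| / (2 * (|K| + |A| + 1)) * K ≤ |A| / 2 := by
    rw [div_mul_eq_mul_div, div_le_div_iff₀ (by positivity) (by positivity)]
    nlinarith [le_abs_self K, abs_nonneg A, abs_nonneg K, mul_le_mul_of_nonneg_left (le_abs_self K) (abs_nonneg A), mul_nonneg (abs_nonneg A) (abs_nonneg A)]
  rw [abs_of_neg hA] at *
  linarith

theorem aux_conv {F : E → ℝ} {gF : E → E} (hg : ∀ x, HasGradientAt F (gF x) x)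
    (hc : ConvexOn ℝ Set.univ F) (x y : E) : F x + ⟪gF x, y - x⟫ ≤ F y := by
  have h1 := aux_line hg x (y - x) 0
  have hc1 : ConvexOn ℝ Set.univ (fun t : ℝ => F (x + t • (y - x))) := by
    have := hc.comp_affineMap (AffineMap.lineMap x y)
    simpa [Function.comp_def, AffineMap.lineMap_apply, add_comm] using this
  have := hc1.le_slope_of_hasDerivAt (Set.mem_univ 0) (Set.mem_univ 1) zero_lt_one h1
  simp [slope_def_field] at this
  linarith

theorem aux_prox {h : E → ℝ} (hc : ConvexOn ℝ Set.univ h) {c : ℝ} {v z zp : E}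
    (hmin : IsMinOn (fun z' => c * ‖z' - z‖ ^ 2 + ⟪v, z'⟫ + h z') Set.univ zp) (u : E) :
    c * ‖zp - z‖ ^ 2 + ⟪v, zp⟫ + h zp + c * ‖zp - u‖ ^ 2 ≤ c * ‖z - u‖ ^ 2 + ⟪v, u⟫ + h u := by
  have key : 0 ≤ (2 * c * ⟪zp - z, u - zp⟫ + ⟪v, u - zp⟫ + h u - h zp) := by
    apply aux_lim (K := c * ‖u - zp‖ ^ 2)
    intro θ h0 h1
    have hm := isMinOn_iff.1 hmin (zp + θ • (u - zp)) (Set.mem_univ _)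
    have hh := hc.2 (Set.mem_univ zp) (Set.mem_univ u) (sub_nonneg.2 h1.le) h0.le (by ring)
    rw [show (1 - θ) • zp + θ • u = zp + θ • (u - zp) by module] at hh
    have e1 : ‖zp + θ • (u - zp) - z‖ ^ 2 =
        ‖zp - z‖ ^ 2 + 2 * (θ * ⟪zp - z, u - zp⟫) + θ ^ 2 * ‖u - zp‖ ^ 2 := by
      rw [show zp + θ • (u - zp) - z = (zp - z) + θ • (u - zp) by module, norm_add_sq_real,
        real_inner_smul_right, norm_smul, mul_pow, Real.norm_eq_abs, sq_abs]
    simp only [e1, inner_add_right, real_inner_smul_right, smul_eq_mul] at hm hh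
    have : 0 ≤ θ * ((2 * c * ⟪zp - z, u - zp⟫ + ⟪v, u - zp⟫ + h u - h zp) + θ * (c * ‖u - zp‖ ^ 2)) := by
      nlinarith
    exact nonneg_of_mul_nonneg_right this h0
  have e2 : ‖z - u‖ ^ 2 = ‖zp - z‖ ^ 2 + 2 * ⟪zp - z, u - zp⟫ + ‖zp - u‖ ^ 2 := by
    rw [norm_sub_rev z u, norm_sub_rev zp u, show u - z = (zp - z) + (u - zp) by module, norm_add_sq_real]
  rw [e2]
  rw [inner_sub_right v] at key
  linarith

/-- Young. -/
theorem aux_young (a b : E) {c : ℝ} (hc : 0 < c) : ⟪a, b⟫ - c * ‖b‖ ^ 2 ≤ ‖a‖ ^ 2 / (4 * c) := by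
  have := real_inner_le_norm a b
  rw [le_div_iff₀ (by positivity)]
  nlinarith [sq_nonneg (‖a‖ - 2 * c * ‖b‖)]

theorem aux_step {F h : E → ℝ} {gF : E → E} (hg : ∀ x, HasGradientAt F (gF x) x) {L : ℝ}
    (hL0 : 0 < L)
    (hL : ∀ x y, ‖gF x - gF y‖ ≤ L * ‖x - y‖)
    (hc : ConvexOn ℝ Set.univ F) (hh : ConvexOn ℝ Set.univ h)
    {τ₁ τ₂ α : ℝ} (h1 : 0 < τ₁) (h2 : 0 ≤ τ₂) (h12 : τ₁ + τ₂ ≤ 1) (hα : α = 1 / (6 * L * τ₁))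
    {x y yp z zp xt v vh : E}
    (hx : x = τ₁ • z + τ₂ • xt + (1 - τ₁ - τ₂) • y)
    (hy : IsMinOn (fun y' => 2 * L * ‖y' - x‖ ^ 2 + ⟪v, y'⟫ + h y') Set.univ yp)
    (hz : IsMinOn (fun z' => (1 / (2 * α)) * ‖z' - z‖ ^ 2 + ⟪vh, z'⟫ + h z') Set.univ zp)
    (u : E) :
    (F yp + h yp) - (F u + h u) ≤ τ₂ * ((F xt + h xt) - (F u + h u))
      + (1 - τ₁ - τ₂) * ((F y + h y) - (F u + h u))
      + 3 * L * τ₁ ^ 2 * (‖z - u‖ ^ 2 - ‖zp - u‖ ^ 2)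
      + (‖vh - v‖ ^ 2 / (4 * L) + ‖v - gF x‖ ^ 2 / (6 * L) - τ₂ * (F xt - F x - ⟪gF x, xt - x⟫))
      + τ₁ * ⟪gF x - vh, z - u⟫ := by
  have hα' : 1 / (2 * α) = 3 * L * τ₁ := by rw [hα]; field_simp; ring
  rw [hα'] at hz
  have hzp := aux_prox hh hz u
  set w := τ₁ • zp + τ₂ • xt + (1 - τ₁ - τ₂) • y with hw
  have hwx : w - x = τ₁ • (zp - z) := by rw [hw, hx]; module
  have hyw := isMinOn_iff.1 hy w (Set.mem_univ _)
  have hwn : ‖w - x‖ ^ 2 = τ₁ ^ 2 * ‖zp - z‖ ^ 2 := by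
    rw [hwx, norm_smul, mul_pow, Real.norm_eq_abs, sq_abs]
  have hhw : h w ≤ τ₁ * h zp + τ₂ * h xt + (1 - τ₁ - τ₂) * h y := by
    have := hh.map_sum_le (t := Finset.univ) (w := ![τ₁, τ₂, 1 - τ₁ - τ₂]) (p := ![zp, xt, y])
      (by intro i _; fin_cases i <;> simp <;> linarith)
      (by simp [Fin.sum_univ_three]) (by simp)
    simpa [Fin.sum_univ_three, hw] using this
  have hdes := aux_descent hg hL x yp
  have hy1 := aux_young (v - gF x) (x - yp) (c := 3 / 2 * L) (by positivity)
  have hy2 := aux_young (vh - v) (x - w) (c := L) hL0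
  have hcu := aux_conv hg hc x u
  have hcy := aux_conv hg hc x y
  have hvw : ⟪vh, w⟫ - ⟪vh, x⟫ = τ₁ * (⟪vh, zp⟫ - ⟪vh, z⟫) := by
    rw [← inner_sub_right, hwx, real_inner_smul_right, inner_sub_right]
  have hgx : ⟪gF x, x⟫ = τ₁ * ⟪gF x, z⟫ + τ₂ * ⟪gF x, xt⟫ + (1 - τ₁ - τ₂) * ⟪gF x, y⟫ := by
    conv_lhs => rw [show ⟪gF x, x⟫ = ⟪gF x, τ₁ • z + τ₂ • xt + (1 - τ₁ - τ₂) • y⟫ by rw [← hx]]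
    simp only [inner_add_right, real_inner_smul_right]
  rw [show 4 * (3 / 2 * L) = 6 * L by ring] at hy1
  rw [norm_sub_rev x yp] at hy1
  rw [norm_sub_rev x w] at hy2
  rw [hwn] at hy2 hyw
  simp only [inner_sub_left, inner_sub_right] at *
  have t1 := mul_le_mul_of_nonneg_left hzp h1.le
  have t2 := mul_le_mul_of_nonneg_left hcu h1.le
  have t3 := mul_le_mul_of_nonneg_left hcy (show 0 ≤ 1 - τ₁ - τ₂ by linarith)
  linarith

end aux

theorem aux_seq {m : ℕ} (hm : 0 < m) {L τ₂ : ℝ} {τ₁ a b A : ℕ → ℝ} (hL : 0 < L)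
    (h20 : 0 < τ₂) (h2 : τ₂ ≤ 1 / 2) (hτ₁ : ∀ s, τ₁ s = 2 / ((s : ℝ) + 4))
    (hstep : ∀ s, ∀ t < m, a (s * m + t + 1) ≤ τ₂ * A s + (1 - τ₁ s - τ₂) * a (s * m + t)
      + 3 * L * τ₁ s ^ 2 * (b (s * m + t) - b (s * m + t + 1)))
    (hA : ∀ s, (m : ℝ) * A (s + 1) ≤ ∑ t ∈ Finset.range m, a (s * m + t + 1))
    (ha : ∀ k, 0 ≤ a k) (hb : ∀ k, 0 ≤ b k) (hA0 : A 0 = a 0) (S : ℕ) :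
    (m : ℝ) * τ₂ * (((S : ℝ) + 4) / 2) ^ 2 * A S ≤ 4 * m * a 0 + 3 * L * b 0 := by
  have hepoch : ∀ s, ∀ j ≤ m, ∑ t ∈ Finset.range j, a (s * m + t + 1) ≤
      j * τ₂ * A s + (1 - τ₁ s - τ₂) *
        (∑ t ∈ Finset.range j, a (s * m + t + 1) + a (s * m) - a (s * m + j))
      + 3 * L * τ₁ s ^ 2 * (b (s * m) - b (s * m + j)) := by
    intro s j
    induction j with
    | zero => intro _; simp
    | succ j ih =>
      intro hj
      have h1 := ih (by omega)
      have h2 := hstep s j (by omega)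
      rw [Finset.sum_range_succ]
      push_cast
      rw [← add_assoc (s * m) j 1]
      linarith
  have hcnn : ∀ s : ℕ, 0 ≤ (((s : ℝ) + 4) / 2) ^ 2 * (1 - τ₂) - ((s : ℝ) + 4) / 2 := by
    intro s
    have : (0 : ℝ) ≤ s := Nat.cast_nonneg s
    nlinarith [mul_nonneg this this]
  have hG : ∀ s : ℕ, (m : ℝ) * τ₂ * (((s : ℝ) + 4) / 2) ^ 2 * A s
      + ((((s : ℝ) + 4) / 2) ^ 2 * (1 - τ₂) - ((s : ℝ) + 4) / 2) * a (s * m) + 3 * L * b (s * m)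
      ≤ 4 * m * a 0 + 3 * L * b 0 := by
    intro s
    induction s with
    | zero =>
      have h1 : (1 : ℝ) ≤ m := by exact_mod_cast hm
      simp [hA0]
      nlinarith [ha 0, mul_nonneg (ha 0) (sub_nonneg.2 h1), mul_nonneg (mul_nonneg (ha 0) (sub_nonneg.2 h1)) (sub_nonneg.2 h2)]
    | succ s ih =>
      refine le_trans ?_ ih
      have he := hepoch s m le_rfl
      have hs : (0 : ℝ) ≤ s := Nat.cast_nonneg s
      have hAs := hA s
      have hle : a (s * m + m) ≤ ∑ t ∈ Finset.range m, a (s * m + t + 1) := by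
        have := Finset.single_le_sum (f := fun t => a (s * m + t + 1)) (s := Finset.range m)
          (fun i _ => ha _) (Finset.mem_range.2 (show m - 1 < m by omega))
        simpa [show s * m + (m - 1) + 1 = s * m + m by omega] using this
      have han := ha (s * m + m)
      rw [show (s + 1) * m = s * m + m by ring]
      generalize (∑ t ∈ Finset.range m, a (s * m + t + 1)) = Sg at *
      push_cast
      obtain ⟨q, hq⟩ : ∃ q : ℝ, q = ((s : ℝ) + 4) / 2 := ⟨_, rfl⟩
      have hq2 : 2 ≤ q := by rw [hq]; linarith
      have hτ : τ₁ s = 1 / q := by rw [hτ₁, hq]; field_simp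
      rw [show ((s : ℝ) + 1 + 4) / 2 = q + 1 / 2 by rw [hq]; ring, ← hq]
      have he2 := mul_le_mul_of_nonneg_left he (sq_nonneg q)
      rw [hτ] at he2
      have e1 : q ^ 2 * (m * τ₂ * A s + (1 - 1 / q - τ₂) * (Sg + a (s * m) - a (s * m + m)) +
          3 * L * (1 / q) ^ 2 * (b (s * m) - b (s * m + m))) =
          m * τ₂ * q ^ 2 * A s + (q ^ 2 * (1 - τ₂) - q) * (Sg + a (s * m) - a (s * m + m)) +
          3 * L * (b (s * m) - b (s * m + m)) := by
        field_simp
        ring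
      rw [e1] at he2
      have t1 := mul_le_mul_of_nonneg_left hAs (show 0 ≤ τ₂ * (q + 1 / 2) ^ 2 by positivity)
      have t2 := mul_le_mul_of_nonneg_left hle (show 0 ≤ q - τ₂ * (q + 1 / 4) by nlinarith)
      nlinarith
  have := hG S
  have := mul_nonneg (hcnn S) (ha (S * m))
  have := mul_nonneg hL.le (hb (S * m))
  linarith

theorem aux_inner_int {Ω : Type*} [MeasureSpace Ω] {E : Type*} [NormedAddCommGroup E]
    [InnerProductSpace ℝ E] {p q : Ω → E}
    (hp : MemLp p 2 ℙ) (hq : MemLp q 2 ℙ) : Integrable (fun ω => ⟪p ω, q ω⟫) := by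
  have h1 := (memLp_two_iff_integrable_sq_norm hp.1).1 hp
  have h2 := (memLp_two_iff_integrable_sq_norm hq.1).1 hq
  refine (h1.add h2).mono' (hp.1.inner hq.1) (Filter.Eventually.of_forall fun ω => ?_)
  have := abs_real_inner_le_norm (p ω) (q ω)
  simp only [Real.norm_eq_abs, Pi.add_apply]
  nlinarith [sq_nonneg (‖p ω‖ - ‖q ω‖), norm_nonneg (p ω), norm_nonneg (q ω)]

theorem aux_inner_zero {Ω : Type*} [MeasureSpace Ω] [IsProbabilityMeasure (ℙ : Measure Ω)]
    {E : Type*} [NormedAddCommGroup E]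
    [InnerProductSpace ℝ E] [CompleteSpace E] {mf : ℕ → MeasurableSpace Ω} {k : ℕ}
    (hm : mf k ≤ (inferInstance : MeasurableSpace Ω)) {v G q : Ω → E}
    (hv : Integrable v) (hvG : MemLp (fun ω => G ω - v ω) 2 ℙ) (hq : MemLp q 2 ℙ)
    (hqm : StronglyMeasurable[mf k] q) (hc : ℙ[v | mf k] =ᵐ[ℙ] G) :
    ∫ ω, ⟪G ω - v ω, q ω⟫ = 0 := by
  have hG : Integrable G := (integrable_congr hc).1 integrable_condExp
  have hcG : ℙ[G | mf k] =ᵐ[ℙ] G := by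
    refine (condExp_congr_ae hc.symm).trans ?_
    refine (condExp_condExp_of_le le_rfl hm).trans hc
  have h0 : ℙ[fun ω => G ω - v ω | mf k] =ᵐ[ℙ] fun _ => 0 := by
    refine (condExp_sub hG hv (mf k)).trans ?_
    filter_upwards [hc, hcG] with ω h1 h2
    simp [h1, h2]
  have h1 := condExp_bilin_of_stronglyMeasurable_right (μ := ℙ) (innerSL ℝ) hqm
    (f := fun ω => G ω - v ω)
    (aux_inner_int hvG hq) (hG.sub hv)
  rw [← integral_condExp hm]
  refine (integral_congr_ae h1).trans ?_
  rw [integral_congr_ae (g := fun _ => (0 : ℝ))]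
  · simp
  · filter_upwards [h0] with ω h
    simp [h]

theorem aux_condbound {Ω : Type*} [MeasureSpace Ω] [IsProbabilityMeasure (ℙ : Measure Ω)]
    {mf : ℕ → MeasurableSpace Ω} {k : ℕ}
    (hm : mf k ≤ (inferInstance : MeasurableSpace Ω)) {p D : Ω → ℝ} {c : ℝ}
    (hD : Integrable D) (hc : ∀ᵐ ω ∂ℙ, (ℙ[p | mf k]) ω ≤ c * D ω) :
    ∫ ω, p ω ≤ c * ∫ ω, D ω := by
  rw [← integral_condExp hm, ← integral_const_mul]
  exact integral_mono_ae integrable_condExp (hD.const_mul c) hc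
theorem alpc_svrg_general_convex_convergence
    {Ω : Type*} [MeasureSpace Ω] [IsProbabilityMeasure (ℙ : Measure Ω)]
    {d n N B m : ℕ} (hn : 0 < n) (hN : 0 < N) (hB : 0 < B) (hm : 0 < m)
    (b dlam : ℕ) (hb : 2 ≤ b) (hdlam : dlam ≤ d)
    (lam : ℝ) (hlam : lam ∈ Set.Ioc (0 : ℝ) 1)
    (L : ℝ) (hL : 0 < L)
    (f : Fin n → EuclideanSpace ℝ (Fin d) → ℝ)
    (g : Fin n → EuclideanSpace ℝ (Fin d) → EuclideanSpace ℝ (Fin d))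
    (hgrad : ∀ j x, HasGradientAt (f j) (g j x) x)
    (hconv : ∀ j, ConvexOn ℝ Set.univ (f j))
    (hsmooth : ∀ j x y, ‖g j x - g j y‖ ≤ L * ‖x - y‖)
    (F : EuclideanSpace ℝ (Fin d) → ℝ) (hF : ∀ y, F y = (n : ℝ)⁻¹ * ∑ j, f j y)
    (gF : EuclideanSpace ℝ (Fin d) → EuclideanSpace ℝ (Fin d))
    (hgF : ∀ x, HasGradientAt F (gF x) x)
    (h : EuclideanSpace ℝ (Fin d) → ℝ) (hconvh : ConvexOn ℝ Set.univ h)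
    (P : EuclideanSpace ℝ (Fin d) → ℝ) (hP : ∀ y, P y = F y + h y)
    (xstar : EuclideanSpace ℝ (Fin d)) (hstar : ∀ y, P xstar ≤ P y)
    -- parameters
    (ζ τ₂ : ℝ) (τ₁ α : ℕ → ℝ)
    (hζ : ζ = (d : ℝ) * lam ^ 2 / (4 * ((2 : ℝ) ^ (b - 1) - 1) ^ 2) +
      (dlam : ℝ) * (1 - lam) ^ 2 + 1 / ((N : ℝ) * (B : ℝ)))
    (hτ₂ : τ₂ = 5 / 3 * ζ + 1 / (2 * (B : ℝ))) (hτ₂le : τ₂ ≤ 1 / 2)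
    (hτ₁ : ∀ s, τ₁ s = 2 / ((s : ℝ) + 4))
    (hα : ∀ s, α s = 1 / (6 * L * τ₁ s))
    -- iterates
    (x0 : EuclideanSpace ℝ (Fin d))
    (x y z : ℕ → Ω → EuclideanSpace ℝ (Fin d))
    (xtil : ℕ → Ω → EuclideanSpace ℝ (Fin d))
    (v vh : ℕ → Ω → EuclideanSpace ℝ (Fin d))
    (hy0 : ∀ ω, y 0 ω = x0) (hz0 : ∀ ω, z 0 ω = x0) (hxtil0 : ∀ ω, xtil 0 ω = x0)
    (hxcomb : ∀ s, ∀ t < m, ∀ ω,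
      x (s * m + t + 1) ω =
        τ₁ s • z (s * m + t) ω + τ₂ • xtil s ω + (1 - τ₁ s - τ₂) • y (s * m + t) ω)
    (hyupdate : ∀ s, ∀ t < m, ∀ ω, IsMinOn
      (fun y' => 2 * L * ‖y' - x (s * m + t + 1) ω‖ ^ 2 + ⟪v (s * m + t + 1) ω, y'⟫ + h y')
      Set.univ (y (s * m + t + 1) ω))
    (hzupdate : ∀ s, ∀ t < m, ∀ ω, IsMinOn
      (fun z' => (1 / (2 * α s)) * ‖z' - z (s * m + t) ω‖ ^ 2 +
        ⟪vh (s * m + t + 1) ω, z'⟫ + h z')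
      Set.univ (z (s * m + t + 1) ω))
    (hxtilsucc : ∀ s ω, xtil (s + 1) ω =
      (m : ℝ)⁻¹ • ∑ t ∈ Finset.range m, y (s * m + t + 1) ω)
    -- a filtration recording "all earlier iterates"
    (mfil : ℕ → MeasurableSpace Ω)
    (hle : ∀ k, mfil k ≤ (inferInstance : MeasurableSpace Ω)) (hmono : Monotone mfil)
    (hady : ∀ k, Measurable[mfil k] (y k)) (hadz : ∀ k, Measurable[mfil k] (z k))
    (hadxtil : ∀ s, Measurable[mfil (s * m)] (xtil s))
    (hadv : ∀ k, Measurable[mfil (k + 1)] (v (k + 1)))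
    (hadvh : ∀ k, Measurable[mfil (k + 1)] (vh (k + 1)))
    (hmeasv : ∀ k, Measurable (v k)) (hmeasvh : ∀ k, Measurable (vh k))
    (hmeasx : ∀ k, Measurable (x k)) (hmeasy : ∀ k, Measurable (y k))
    (hmeasz : ∀ k, Measurable (z k)) (hmeasxtil : ∀ s, Measurable (xtil s))
    -- integrability
    (hintPy : ∀ k, Integrable fun ω => P (y k ω))
    (hintz : ∀ k, Integrable fun ω => ‖z k ω‖ ^ 2)
    (hintPxtil : ∀ s, Integrable fun ω => P (xtil s ω))
    (hintPx : ∀ k, Integrable fun ω => P (x (k + 1) ω))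
    (hintvh : ∀ k, Integrable (vh (k + 1)))
    (hintvhvar : ∀ k, Integrable fun ω => ‖vh (k + 1) ω - gF (x (k + 1) ω)‖ ^ 2)
    (hintvvar : ∀ k, Integrable fun ω => ‖v (k + 1) ω - gF (x (k + 1) ω)‖ ^ 2)
    (hintdiff : ∀ k, Integrable fun ω => ‖vh (k + 1) ω - v (k + 1) ω‖ ^ 2)
    (hintD : ∀ s, ∀ t < m, Integrable fun ω =>
      F (xtil s ω) - F (x (s * m + t + 1) ω) -
        ⟪gF (x (s * m + t + 1) ω), xtil s ω - x (s * m + t + 1) ω⟫)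
    -- conditional second-moment bounds on the two gradient estimators
    (hvhmean : ∀ s, ∀ t < m,
      (ℙ[vh (s * m + t + 1) | mfil (s * m + t)]) =ᵐ[ℙ]
        fun ω => gF (x (s * m + t + 1) ω))
    (hvhvar : ∀ s, ∀ t < m, ∀ᵐ ω ∂ℙ,
      (ℙ[fun ω' => ‖vh (s * m + t + 1) ω' - gF (x (s * m + t + 1) ω')‖ ^ 2 |
          mfil (s * m + t)]) ω ≤
        (2 * L / (B : ℝ)) *
          (F (xtil s ω) - F (x (s * m + t + 1) ω) -
            ⟪gF (x (s * m + t + 1) ω), xtil s ω - x (s * m + t + 1) ω⟫))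
    (hvvar : ∀ s, ∀ t < m, ∀ᵐ ω ∂ℙ,
      (ℙ[fun ω' => ‖v (s * m + t + 1) ω' - gF (x (s * m + t + 1) ω')‖ ^ 2 |
          mfil (s * m + t)]) ω ≤
        4 * L * ζ *
          (F (xtil s ω) - F (x (s * m + t + 1) ω) -
            ⟪gF (x (s * m + t + 1) ω), xtil s ω - x (s * m + t + 1) ω⟫))
    (hdiffvar : ∀ s, ∀ t < m, ∀ᵐ ω ∂ℙ,
      (ℙ[fun ω' => ‖vh (s * m + t + 1) ω' - v (s * m + t + 1) ω'‖ ^ 2 |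
          mfil (s * m + t)]) ω ≤
        4 * L * (ζ + 1 / (2 * (B : ℝ))) *
          (F (xtil s ω) - F (x (s * m + t + 1) ω) -
            ⟪gF (x (s * m + t + 1) ω), xtil s ω - x (s * m + t + 1) ω⟫)) :
    ∃ C : ℝ, 0 < C ∧ ∀ S : ℕ, 1 ≤ S →
      (∫ ω, P (xtil S ω)) - P xstar ≤
        C / ((m : ℝ) * (S : ℝ) ^ 2) *
          ((m : ℝ) * (P x0 - P xstar) + L * ‖x0 - xstar‖ ^ 2) := by

  have hn' : (0 : ℝ) < n := by exact_mod_cast hn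
  have hB' : (0 : ℝ) < B := by exact_mod_cast hB
  have hN' : (0 : ℝ) < N := by exact_mod_cast hN
  have hm' : (0 : ℝ) < m := by exact_mod_cast hm
  have hζ0 : 0 < ζ := by rw [hζ]; positivity
  have hτ₂0 : 0 < τ₂ := by rw [hτ₂]; positivity
  have hτ₁0 : ∀ s, 0 < τ₁ s := fun s => by rw [hτ₁]; positivity
  have hτ₁1 : ∀ s, τ₁ s ≤ 1 / 2 := fun s => by
    rw [hτ₁, div_le_div_iff₀ (by positivity) (by norm_num)]
    have : (0 : ℝ) ≤ s := Nat.cast_nonneg s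
    linarith
  have hgFeq : ∀ p, gF p = (n : ℝ)⁻¹ • ∑ j, g j p := by
    intro p
    refine (hgF p).unique ?_
    rw [hasGradientAt_iff_hasFDerivAt, map_smul, map_sum]
    have h1 := (HasFDerivAt.fun_sum (u := Finset.univ)
      fun j _ => (hgrad j p).hasFDerivAt).const_mul (n : ℝ)⁻¹
    exact h1.congr_of_eventuallyEq (Filter.Eventually.of_forall hF)
  have hgFL : ∀ p q, ‖gF p - gF q‖ ≤ L * ‖p - q‖ := by
    intro p q
    rw [hgFeq, hgFeq, ← smul_sub, ← Finset.sum_sub_distrib, norm_smul, Real.norm_of_nonneg (by positivity)]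
    have h1 : ‖∑ j, (g j p - g j q)‖ ≤ n * (L * ‖p - q‖) := by
      refine (norm_sum_le _ _).trans ((Finset.sum_le_sum fun j _ => hsmooth j p q).trans ?_)
      simp
    calc (n : ℝ)⁻¹ * ‖∑ j, (g j p - g j q)‖ ≤ (n : ℝ)⁻¹ * (n * (L * ‖p - q‖)) := by gcongr
      _ = _ := by field_simp
  have hFc : ConvexOn ℝ Set.univ F := by
    refine ⟨convex_univ, fun p _ q _ a b ha hb hab => ?_⟩
    simp only [hF, smul_eq_mul]
    have h1 : ∑ j, f j (a • p + b • q) ≤ a * ∑ j, f j p + b * ∑ j, f j q := by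
      rw [Finset.mul_sum, Finset.mul_sum, ← Finset.sum_add_distrib]
      refine Finset.sum_le_sum fun j _ => ?_
      simpa using (hconv j).2 (Set.mem_univ p) (Set.mem_univ q) ha hb hab
    have h2 := mul_le_mul_of_nonneg_left h1 (inv_nonneg.2 hn'.le)
    linarith
  have hgFc : Continuous gF := by
    have : LipschitzWith ⟨L, hL.le⟩ gF := LipschitzWith.of_dist_le_mul fun p q => by
      rw [dist_eq_norm, dist_eq_norm]; exact hgFL p q
    exact this.continuous
  have hPc : ConvexOn ℝ Set.univ P := by
    have : P = F + h := funext hP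
    rw [this]; exact hFc.add hconvh
  have hzL : ∀ k, MemLp (fun ω => z k ω - xstar) 2 ℙ := by
    intro k
    exact ((memLp_two_iff_integrable_sq_norm (hmeasz k).aestronglyMeasurable).2 (hintz k)).sub
      (memLp_const xstar)
  have hzI : ∀ k, Integrable (fun ω => ‖z k ω - xstar‖ ^ 2) := fun k =>
    (memLp_two_iff_integrable_sq_norm (hzL k).1).1 (hzL k)
  have hvG : ∀ k, MemLp (fun ω => gF (x (k + 1) ω) - vh (k + 1) ω) 2 ℙ := by
    intro k
    refine (memLp_two_iff_integrable_sq_norm ?_).2 ?_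
    · exact ((hgFc.measurable.comp (hmeasx _)).sub (hmeasvh _)).aestronglyMeasurable
    · simpa only [norm_sub_rev] using hintvhvar k
  have hstep : ∀ s, ∀ t < m, (∫ ω, P (y (s * m + t + 1) ω)) - P xstar ≤
      τ₂ * ((∫ ω, P (xtil s ω)) - P xstar) +
      (1 - τ₁ s - τ₂) * ((∫ ω, P (y (s * m + t) ω)) - P xstar) +
      3 * L * τ₁ s ^ 2 * ((∫ ω, ‖z (s * m + t) ω - xstar‖ ^ 2) -
        ∫ ω, ‖z (s * m + t + 1) ω - xstar‖ ^ 2) := by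
    intro s t ht
    have hpt := fun ω => aux_step hgF hL hgFL hFc hconvh (hτ₁0 s) hτ₂0.le
      (by have := hτ₁1 s; linarith) (hα s) (hxcomb s t ht ω) (hyupdate s t ht ω)
      (hzupdate s t ht ω) xstar
    simp only [← hP] at hpt
    have hD := hintD s t ht
    have b1 := aux_condbound (hle _) hD (hvvar s t ht)
    have b2 := aux_condbound (hle _) hD (hdiffvar s t ht)
    have i0 := aux_inner_zero (hle (s * m + t)) (hintvh (s * m + t)) (hvG (s * m + t))
      (hzL (s * m + t)) ((hadz (s * m + t)).sub_const xstar).stronglyMeasurable (hvhmean s t ht)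
    have I0 := aux_inner_int (hvG (s * m + t)) (hzL (s * m + t))
    have J1 := (hintPy (s * m + t + 1)).sub (integrable_const (P xstar))
    have J2 := ((hintPxtil s).sub (integrable_const (P xstar))).const_mul τ₂
    have J3 := ((hintPy (s * m + t)).sub (integrable_const (P xstar))).const_mul (1 - τ₁ s - τ₂)
    have J4 := ((hzI (s * m + t)).sub (hzI (s * m + t + 1))).const_mul (3 * L * τ₁ s ^ 2)
    have J5a := (hintdiff (s * m + t)).div_const (4 * L)
    have J5b := (hintvvar (s * m + t)).div_const (6 * L)
    have J5c := hD.const_mul τ₂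
    have J6 := I0.const_mul (τ₁ s)
    have key := integral_mono J1 (((((J2.add J3).add J4).add ((J5a.add J5b).sub J5c)).add J6)) hpt
    rw [integral_add' (((J2.add J3).add J4).add ((J5a.add J5b).sub J5c)) J6,
      integral_add' ((J2.add J3).add J4) ((J5a.add J5b).sub J5c),
      integral_add' (J2.add J3) J4, integral_add' J2 J3, integral_sub' (J5a.add J5b) J5c,
      integral_add' J5a J5b] at key
    simp only [Pi.sub_apply, integral_const_mul, integral_div] at key
    rw [integral_sub (hintPy _) (integrable_const _), integral_sub (hintPy _) (integrable_const _),
      integral_sub (hintPxtil _) (integrable_const _), integral_sub (hzI _) (hzI _), i0] at key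
    simp only [integral_const, probReal_univ, one_smul] at key
    refine key.trans ?_
    generalize (∫ ω, F (xtil s ω) - F (x (s * m + t + 1) ω) -
            ⟪gF (x (s * m + t + 1) ω), xtil s ω - x (s * m + t + 1) ω⟫) = DD at *
    have c1 : (∫ ω, ‖vh (s * m + t + 1) ω - v (s * m + t + 1) ω‖ ^ 2) / (4 * L) ≤
        (ζ + 1 / (2 * (B : ℝ))) * DD := by
      rw [div_le_iff₀ (by positivity)]; linarith
    have c2 : (∫ ω, ‖v (s * m + t + 1) ω - gF (x (s * m + t + 1) ω)‖ ^ 2) / (6 * L) ≤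
        2 / 3 * ζ * DD := by
      rw [div_le_iff₀ (by positivity)]; linarith
    have c3 : τ₂ * DD = (ζ + 1 / (2 * (B : ℝ))) * DD + 2 / 3 * ζ * DD := by rw [hτ₂]; ring
    linarith
  have hA : ∀ s, (m : ℝ) * ((∫ ω, P (xtil (s + 1) ω)) - P xstar) ≤
      ∑ t ∈ Finset.range m, ((∫ ω, P (y (s * m + t + 1) ω)) - P xstar) := by
    intro s
    have h1 : ∀ ω, (m : ℝ) * P (xtil (s + 1) ω) ≤ ∑ t ∈ Finset.range m, P (y (s * m + t + 1) ω) := by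
      intro ω
      have := hPc.map_sum_le (t := Finset.range m) (w := fun _ => (m : ℝ)⁻¹)
        (p := fun t => y (s * m + t + 1) ω) (fun _ _ => by positivity)
        (by simp [hm'.ne']) (fun _ _ => Set.mem_univ _)
      rw [← Finset.smul_sum, ← Finset.smul_sum, ← hxtilsucc, smul_eq_mul] at this
      calc _ ≤ (m : ℝ) * ((m : ℝ)⁻¹ * ∑ t ∈ Finset.range m, P (y (s * m + t + 1) ω)) := by gcongr
        _ = _ := by field_simp
    have h2 := integral_mono ((hintPxtil (s + 1)).const_mul (m : ℝ))
      (integrable_finsetSum (Finset.range m) fun t _ => hintPy (s * m + t + 1)) h1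
    rw [integral_const_mul, integral_finsetSum _ fun t _ => hintPy (s * m + t + 1)] at h2
    rw [Finset.sum_sub_distrib]
    simp only [Finset.sum_const, Finset.card_range, nsmul_eq_mul]
    linarith
  have hmain := aux_seq hm (a := fun k => (∫ ω, P (y k ω)) - P xstar)
    (b := fun k => ∫ ω, ‖z k ω - xstar‖ ^ 2) (A := fun s => (∫ ω, P (xtil s ω)) - P xstar)
    hL hτ₂0 hτ₂le hτ₁ hstep hA
    (fun k => by
      have := integral_mono (integrable_const (P xstar)) (hintPy k) (fun ω => hstar _)
      simp at this
      simpa using this)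
    (fun k => integral_nonneg fun ω => by positivity)
    (by simp [hxtil0, hy0])
  refine ⟨16 / τ₂, by positivity, fun S hS => ?_⟩
  have h1 := hmain S
  simp only [hy0, hz0, integral_const, probReal_univ, one_smul] at h1
  have hS' : (0 : ℝ) < S := by exact_mod_cast hS
  have hnn : 0 ≤ (∫ ω, P (xtil S ω)) - P xstar := by
    have := integral_mono (integrable_const (P xstar)) (hintPxtil S) (fun ω => hstar _)
    simp at this
    simpa using this
  rw [div_div, div_mul_eq_mul_div, le_div_iff₀ (by positivity)]
  have h2 : (m : ℝ) * τ₂ * ((S : ℝ) / 2) ^ 2 * ((∫ ω, P (xtil S ω)) - P xstar) ≤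
      (m : ℝ) * τ₂ * (((S : ℝ) + 4) / 2) ^ 2 * ((∫ ω, P (xtil S ω)) - P xstar) := by
    gcongr
    linarith
  have h3 : 0 ≤ L * ‖x0 - xstar‖ ^ 2 := by positivity
  have h4 : 0 ≤ (m : ℝ) * (P x0 - P xstar) := mul_nonneg hm'.le (sub_nonneg.2 (hstar _))
  linarith
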